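/- arXiv:2507.15175 — 6 statements merged into one kernel-verified Lean document; each statement's English description precedes it below -/
import Mathlib

section
/- Let A be a (not necessarily commutative) ring, let p ≥ 1 and J ≥ 1 be integers, and let a, θ ∈ A be commuting elements (aθ = θa) with θ^p = 0. Then (θ − a) · (1 + Σ_{j=1}^{J} Σ_{q=0}^{p−1} a^{p^j − q − 1} · θ^q) = θ − Σ_{j=0}^{J} a^{p^j}. -/
/-- A truncated geometric sum in two commuting variables telescopes. -/
theorem Commute.sub_mul_sum_range_pow_mul_pow {A : Type*} [Ring A] {a θ : A} (h : Commute a θ)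
    {m n : ℕ} (hmn : m ≤ n) :
    (θ - a) * ∑ q ∈ Finset.range m, a ^ (n - q - 1) * θ ^ q = a ^ (n - m) * θ ^ m - a ^ n := by
  induction m with
  | zero => simp
  | succ m ih =>
    have hn : n - m = n - m - 1 + 1 := by omega
    have hθ : θ * (a ^ (n - m - 1) * θ ^ m) = a ^ (n - m - 1) * θ ^ (m + 1) := by
      rw [← mul_assoc, ← (h.pow_left _).eq, mul_assoc, ← pow_succ']
    have ha : a * (a ^ (n - m - 1) * θ ^ m) = a ^ (n - m) * θ ^ m := by
      rw [← mul_assoc, ← pow_succ', ← hn]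
    rw [Finset.sum_range_succ, mul_add, ih (by omega), sub_mul, hθ, ha, ← Nat.sub_sub]
    abel

/-- Let `A` be a (not necessarily commutative) ring, `p ≥ 1`, `J ≥ 1` integers, and
`a, θ ∈ A` commuting elements with `θ^p = 0`.  Then
`(θ − a) · (1 + Σ_{j=1}^{J} Σ_{q=0}^{p−1} a^(p^j − q − 1) · θ^q) = θ − Σ_{j=0}^{J} a^(p^j)`. -/
theorem statement0 {A : Type*} [Ring A] (p J : ℕ) (hp : 1 ≤ p) (hJ : 1 ≤ J)
    (a θ : A) (hcomm : a * θ = θ * a) (hθ : θ ^ p = 0) :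
    (θ - a) * (1 + ∑ j ∈ Finset.Icc 1 J, ∑ q ∈ Finset.range p, a ^ (p ^ j - q - 1) * θ ^ q) =
      θ - ∑ j ∈ Finset.range (J + 1), a ^ p ^ j := by
  have key (j : ℕ) (hj : 1 ≤ j) :
      (θ - a) * ∑ q ∈ Finset.range p, a ^ (p ^ j - q - 1) * θ ^ q = -a ^ p ^ j := by
    rw [Commute.sub_mul_sum_range_pow_mul_pow hcomm (Nat.le_self_pow (by omega) p), hθ, mul_zero,
      zero_sub]
  clear hJ
  induction J with
  | zero => simp
  | succ J ih =>
    rw [Finset.sum_Icc_succ_top (by omega), ← add_assoc, mul_add, ih, key _ (by omega),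
      Finset.sum_range_succ _ (J + 1)]
    abel
end

section
/- Let p be a prime and R a commutative ring with p·1_R = 0. Fix n ≥ 1 and, for every function α from {1,…,n} to {0,1,…,p−1}, a polynomial h_α in the polynomial ring R[X₁,…,X_n]; set f_α := h_α^p · X₁^{α(1)} ⋯ X_n^{α(n)} and f := Σ_α f_α. Then for every 1 ≤ q ≤ n and every integer J ≥ 0: Σ_α Σ_{j=0}^{J} f_α^{p^j − 1} · (X_q · ∂_q f_α) = Σ_{j=0}^{J} (X_q · ∂_q f)^{p^j}. -/
open MvPolynomial in
/-- The Euler operator `X_q ∂_q` multiplies `g ^ p * X ^ a` by `a q` in characteristic `p`. -/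
theorem MvPolynomial.X_mul_pderiv_pow_char_mul_prod {σ R : Type*} [Fintype σ] [CommRing R]
    (p : ℕ) [CharP R p] (g : MvPolynomial σ R) (a : σ → ℕ) (q : σ) :
    X q * pderiv q (g ^ p * ∏ i, X i ^ a i) =
      (a q : MvPolynomial σ R) * (g ^ p * ∏ i, X i ^ a i) := by
  have hm : (∏ i, X i ^ a i : MvPolynomial σ R) =
      monomial (Finsupp.equivFunOnFinite.symm a) 1 := by
    rw [monomial_eq, Finsupp.prod_fintype _ _ (fun i => pow_zero _)]
    simp
  have hpow : pderiv q (g ^ p) = 0 := by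
    rw [Derivation.leibniz_pow, ← Nat.cast_smul_eq_nsmul R, CharP.cast_eq_zero, zero_smul]
  have hX := X_mul_pderiv_monomial (i := q) (m := Finsupp.equivFunOnFinite.symm a) (r := (1 : R))
  rw [← hm, nsmul_eq_mul, Finsupp.equivFunOnFinite_symm_apply_apply] at hX
  rw [Derivation.leibniz, hpow, smul_zero, add_zero, smul_eq_mul, mul_left_comm, hX]
  ring

/-- Let `p` be a prime and `R` a commutative ring with `p·1 = 0`.  Fix `n ≥ 1` and, for
every function `α : {1,…,n} → {0,…,p−1}`, a polynomial `h α ∈ R[X₁,…,X_n]`; set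
`fα α := (h α)^p · Π_i X_i^(α i)` and `f := Σ_α fα α`.  Then for every variable `q`
and every `J ≥ 0`:
`Σ_α Σ_{j=0}^{J} (fα α)^(p^j − 1) · (X_q · ∂_q (fα α)) = Σ_{j=0}^{J} (X_q · ∂_q f)^(p^j)`. -/
theorem statement2 {p : ℕ} (hp : p.Prime) {R : Type*} [CommRing R] [CharP R p]
    {n : ℕ} (hn : 1 ≤ n) (h : (Fin n → Fin p) → MvPolynomial (Fin n) R)
    (fa : (Fin n → Fin p) → MvPolynomial (Fin n) R)
    (hfa : ∀ α, fa α = h α ^ p * ∏ i : Fin n, MvPolynomial.X i ^ (α i : ℕ))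
    (f : MvPolynomial (Fin n) R) (hf : f = ∑ α : Fin n → Fin p, fa α)
    (q : Fin n) (J : ℕ) :
    ∑ α : Fin n → Fin p, ∑ j ∈ Finset.range (J + 1),
        fa α ^ (p ^ j - 1) * (MvPolynomial.X q * MvPolynomial.pderiv q (fa α))
      = ∑ j ∈ Finset.range (J + 1),
        (MvPolynomial.X q * MvPolynomial.pderiv q f) ^ p ^ j := by
  have : Fact p.Prime := ⟨hp⟩
  have euler : ∀ α, MvPolynomial.X q * MvPolynomial.pderiv q (fa α) =
      ((α q : ℕ) : MvPolynomial (Fin n) R) * fa α := fun α => by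
    rw [hfa α]
    exact MvPolynomial.X_mul_pderiv_pow_char_mul_prod p (h α) (fun i => α i) q
  have frob_cast : ∀ j m : ℕ, (m : MvPolynomial (Fin n) R) ^ p ^ j = m := fun j m => by
    rw [← iterateFrobenius_def, map_natCast]
  rw [Finset.sum_comm, hf, map_sum, Finset.mul_sum]
  refine Finset.sum_congr rfl fun j _ => ?_
  rw [sum_pow_char_pow]
  refine Finset.sum_congr rfl fun α _ => ?_
  rw [euler, mul_pow, frob_cast, mul_left_comm, pow_sub_one_mul (pow_ne_zero j hp.ne_zero)]
end

section
/- Let R be a commutative ring, let x₁, x₂, … and y₁, y₂, … be elements of R, and let c ≤ b ≤ a ≤ r be positive integers. For b ≤ u ≤ a set f_u := (Π_{q=c}^{u−1} Σ_{l=q}^{a} y_l) · (Π_{q=u+1}^{a} Σ_{l=q}^{r} (x_l + y_l)), and set z := Σ_{u=a+1}^{r} (x_u + y_u). Then (Π_{u=c}^{b−1} Σ_{v=u}^{a} y_v) · ( Π_{u=b}^{a} Σ_{l=u}^{r} (x_l + y_l) − Π_{u=b}^{a} Σ_{l=u}^{a} y_l ) = z · Σ_{u=b}^{a} f_u + Σ_{u=b}^{a}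 x_u · ( Σ_{l=b}^{u} f_l ). -/
/-- Telescoping a difference of two products over an integer interval. -/
lemma prod_Ico_mul_prod_Ico_sub_prod_Ico {R : Type*} [CommRing R] (A B : ℕ → R) {c b n : ℕ}
    (hcb : c ≤ b) (hbn : b ≤ n) :
    (∏ q ∈ Finset.Ico c b, A q) * ((∏ q ∈ Finset.Ico b n, B q) - ∏ q ∈ Finset.Ico b n, A q) =
      ∑ u ∈ Finset.Ico b n,
        ((∏ q ∈ Finset.Ico c u, A q) * ∏ q ∈ Finset.Ico (u + 1) n, B q) * (B u - A u) := by
  have key : ∀ u ∈ Finset.Ico b n,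
      ((∏ q ∈ Finset.Ico c u, A q) * ∏ q ∈ Finset.Ico (u + 1) n, B q) * (B u - A u) =
        -((∏ q ∈ Finset.Ico c (u + 1), A q) * (∏ q ∈ Finset.Ico (u + 1) n, B q) -
          (∏ q ∈ Finset.Ico c u, A q) * ∏ q ∈ Finset.Ico u n, B q) := by
    intro u hu
    obtain ⟨hbu, hun⟩ := Finset.mem_Ico.1 hu
    rw [Finset.prod_Ico_succ_top (hcb.trans hbu), Finset.prod_eq_prod_Ico_succ_bot hun]
    ring
  rw [Finset.sum_congr rfl key, Finset.sum_neg_distrib,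
    Finset.sum_Ico_sub (fun u => (∏ q ∈ Finset.Ico c u, A q) * ∏ q ∈ Finset.Ico u n, B q) hbn,
    ← Finset.prod_Ico_consecutive A hcb hbn, Finset.Ico_self, Finset.prod_empty]
  ring

/-- Let `R` be a commutative ring, `x, y : ℕ → R`, and `1 ≤ c ≤ b ≤ a ≤ r`.  For
`b ≤ u ≤ a` set `f u := (Π_{q=c}^{u−1} Σ_{l=q}^{a} y l) · (Π_{q=u+1}^{a} Σ_{l=q}^{r} (x l + y l))`
and `z := Σ_{u=a+1}^{r} (x u + y u)`.  Then
`(Π_{u=c}^{b−1} Σ_{v=u}^{a} y v) · (Π_{u=b}^{a} Σ_{l=u}^{r} (x l + y l) − Π_{u=b}^{a} Σ_{l=u}^{a} y l)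
  = z · Σ_{u=b}^{a} f u + Σ_{u=b}^{a} x u · (Σ_{l=b}^{u} f l)`. -/
theorem statement4 {R : Type*} [CommRing R] (x y : ℕ → R) (c b a r : ℕ)
    (hc : 1 ≤ c) (hcb : c ≤ b) (hba : b ≤ a) (har : a ≤ r)
    (f : ℕ → R)
    (hf : ∀ u, f u = (∏ q ∈ Finset.Icc c (u - 1), ∑ l ∈ Finset.Icc q a, y l) *
      (∏ q ∈ Finset.Icc (u + 1) a, ∑ l ∈ Finset.Icc q r, (x l + y l)))
    (z : R) (hz : z = ∑ u ∈ Finset.Icc (a + 1) r, (x u + y u)) :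
    (∏ u ∈ Finset.Icc c (b - 1), ∑ v ∈ Finset.Icc u a, y v) *
      ((∏ u ∈ Finset.Icc b a, ∑ l ∈ Finset.Icc u r, (x l + y l)) -
        ∏ u ∈ Finset.Icc b a, ∑ l ∈ Finset.Icc u a, y l)
    = z * (∑ u ∈ Finset.Icc b a, f u) +
      ∑ u ∈ Finset.Icc b a, x u * ∑ l ∈ Finset.Icc b u, f l := by
  have hA : ∀ {m n : ℕ} (g : ℕ → R), 1 ≤ n →
      ∏ q ∈ Finset.Icc m (n - 1), g q = ∏ q ∈ Finset.Ico m n, g q := by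
    intro m n g hn
    congr 1
    ext q
    simp only [Finset.mem_Icc, Finset.mem_Ico]
    omega
  have hdiff : ∀ u ∈ Finset.Icc b a,
      (∑ l ∈ Finset.Icc u r, (x l + y l)) - ∑ l ∈ Finset.Icc u a, y l =
        z + ∑ l ∈ Finset.Icc u a, x l := by
    intro u hu
    have hua : u ≤ a + 1 := (Finset.mem_Icc.1 hu).2.trans a.le_succ
    simp only [hz, ← Finset.Ico_add_one_right_eq_Icc]
    rw [← Finset.sum_Ico_consecutive _ hua (by gcongr : a + 1 ≤ r + 1), Finset.sum_add_distrib]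
    ring
  have hswap : ∑ u ∈ Finset.Icc b a, x u * ∑ l ∈ Finset.Icc b u, f l =
      ∑ u ∈ Finset.Icc b a, f u * ∑ l ∈ Finset.Icc u a, x l := by
    simp only [Finset.mul_sum]
    rw [Finset.sum_comm' (t' := Finset.Icc b a) (s' := fun l => Finset.Icc l a)]
    · simp only [mul_comm]
    · intro u l
      simp only [Finset.mem_Icc]
      omega
  have htel := prod_Ico_mul_prod_Ico_sub_prod_Ico (fun q => ∑ l ∈ Finset.Icc q a, y l)
    (fun q => ∑ l ∈ Finset.Icc q r, (x l + y l)) hcb (hba.trans a.le_succ)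
  simp only [Nat.succ_eq_add_one, Finset.Ico_add_one_right_eq_Icc] at htel
  rw [hA _ (hc.trans hcb), htel, hswap, Finset.mul_sum, ← Finset.sum_add_distrib]
  refine Finset.sum_congr rfl fun u hu => ?_
  rw [hdiff u hu, hf u, hA _ (hc.trans (hcb.trans (Finset.mem_Icc.1 hu).1))]
  ring
end

section
/- Let R be a commutative ring, let x₁, x₂, … and y₁, y₂, … be elements of R, and let b ≤ l < q ≤ a ≤ r be positive integers. For b ≤ u ≤ a set f_u := (Π_{v=b}^{u−1} Σ_{w=v}^{a} y_w) · (Π_{v=u+1}^{a} Σ_{w=v}^{r} (x_w + y_w)). Then (Σ_{u=l+1}^{r} (x_u + y_u)) · (Σ_{u=l+2}^{q} f_u) + (Σ_{u=l+1}^{a} y_u) · (Σ_{u=b}^{l} f_u) + (x_l + y_l) · (Σ_{u=l+1}^{q} f_u) + y_l · (Σ_{u=b}^{l} f_u) = (Σ_{u=l}^{r} (x_u + y_u)) · (Σ_{u=l+1}^{q} f_u) + (Σ_{u=l}^{a} y_u) · (Σ_{u=b}^{l−1} f_u). -/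
/-- Split off the lowest factor of a product over an integer interval. -/
theorem prod_Icc_eq_mul_prod_Icc_succ {M : Type*} [CommMonoid M] (g : ℕ → M) {m n : ℕ}
    (h : m ≤ n) : ∏ i ∈ Finset.Icc m n, g i = g m * ∏ i ∈ Finset.Icc (m + 1) n, g i := by
  rw [← Finset.insert_Icc_add_one_left_eq_Icc h, Finset.prod_insert (by simp)]

/-- Split off the lowest summand of a sum over an integer interval. -/
theorem sum_Icc_eq_add_sum_Icc_succ {M : Type*} [AddCommMonoid M] (g : ℕ → M) {m n : ℕ}
    (h : m ≤ n) : ∑ i ∈ Finset.Icc m n, g i = g m + ∑ i ∈ Finset.Icc (m + 1) n, g i := by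
  rw [← Finset.insert_Icc_add_one_left_eq_Icc h, Finset.sum_insert (by simp)]

/-- Let `R` be a commutative ring, `x, y : ℕ → R`, and `1 ≤ b ≤ l < q ≤ a ≤ r`.  For
`b ≤ u ≤ a` set
`f u := (Π_{v=b}^{u−1} Σ_{w=v}^{a} y w) · (Π_{v=u+1}^{a} Σ_{w=v}^{r} (x w + y w))`.  Then
`(Σ_{u=l+1}^{r} (x u + y u))·(Σ_{u=l+2}^{q} f u) + (Σ_{u=l+1}^{a} y u)·(Σ_{u=b}^{l} f u)
 + (x l + y l)·(Σ_{u=l+1}^{q} f u) + y l·(Σ_{u=b}^{l} f u)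
 = (Σ_{u=l}^{r} (x u + y u))·(Σ_{u=l+1}^{q} f u) + (Σ_{u=l}^{a} y u)·(Σ_{u=b}^{l−1} f u)`. -/
theorem statement5 {R : Type*} [CommRing R] (x y : ℕ → R) (b l q a r : ℕ)
    (hb : 1 ≤ b) (hbl : b ≤ l) (hlq : l < q) (hqa : q ≤ a) (har : a ≤ r)
    (f : ℕ → R)
    (hf : ∀ u, f u = (∏ v ∈ Finset.Icc b (u - 1), ∑ w ∈ Finset.Icc v a, y w) *
      (∏ v ∈ Finset.Icc (u + 1) a, ∑ w ∈ Finset.Icc v r, (x w + y w))) :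
    (∑ u ∈ Finset.Icc (l + 1) r, (x u + y u)) * (∑ u ∈ Finset.Icc (l + 2) q, f u) +
      (∑ u ∈ Finset.Icc (l + 1) a, y u) * (∑ u ∈ Finset.Icc b l, f u) +
      (x l + y l) * (∑ u ∈ Finset.Icc (l + 1) q, f u) +
      y l * (∑ u ∈ Finset.Icc b l, f u)
    = (∑ u ∈ Finset.Icc l r, (x u + y u)) * (∑ u ∈ Finset.Icc (l + 1) q, f u) +
      (∑ u ∈ Finset.Icc l a, y u) * (∑ u ∈ Finset.Icc b (l - 1), f u) := by
  obtain ⟨m, rfl⟩ : ∃ m, l = m + 1 := ⟨l - 1, by omega⟩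
  have one_step : (∑ u ∈ Finset.Icc (m + 1 + 1) r, (x u + y u)) * f (m + 1 + 1) =
      (∑ u ∈ Finset.Icc (m + 1) a, y u) * f (m + 1) := by
    rw [hf, hf, Nat.add_sub_cancel, Nat.add_sub_cancel, Finset.prod_Icc_succ_top hbl,
      prod_Icc_eq_mul_prod_Icc_succ _ (show m + 1 + 1 ≤ a by omega)]
    ring
  rw [sum_Icc_eq_add_sum_Icc_succ f (show m + 1 + 1 ≤ q by omega),
    sum_Icc_eq_add_sum_Icc_succ _ (show m + 1 ≤ r by omega), Finset.sum_Icc_succ_top hbl,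
    Nat.add_sub_cancel]
  rw [sum_Icc_eq_add_sum_Icc_succ y (show m + 1 ≤ a by omega)] at one_step ⊢
  linear_combination -one_step
end

section
/- Let k be a perfect field of characteristic p > 0 and let f ∈ k⟦t⟧ be a formal power series whose formal derivative f′ is nonzero. Then the k-linear map k⟦t⟧ → k⟦t⟧ sending u to u′ + f′·u is injective, and its cokernel is a finite-dimensional k-vector space of dimension equal to ord(f′). -/
open Polynomial

/-- The twisted derivation `u ↦ d u + h u`. -/
noncomputable def Derivation.twist {k A : Type*} [CommRing k] [CommRing A] [Algebra k A]
    (d : Derivation k A A) (h : A) : Module.End k A :=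
  d.toLinearMap + LinearMap.mulLeft k h

namespace Derivation

variable {k A : Type*} [CommRing A]

section CommRing

variable [CommRing k] [Algebra k A] (d : Derivation k A A)

@[simp]
theorem twist_apply (h u : A) : d.twist h u = d u + h * u := rfl

theorem ad_twist_pow_mulLeft (h u : A) (n : ℕ) :
    ((LinearMap.mulLeft k (d.twist h) - LinearMap.mulRight k (d.twist h)) ^ n)
      (LinearMap.mulLeft k u) = LinearMap.mulLeft k (d^[n] u) := by
  induction n with
  | zero => simp
  | succ n ih =>
    rw [pow_succ', Module.End.mul_apply, ih, Function.iterate_succ_apply']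
    ext v
    simp
    ring

/-- Coefficientwise application of a derivation, as a derivation of the polynomial ring. -/
noncomputable def polynomial : Derivation k A[X] A[X] :=
  PolynomialModule.equivPolynomialSelf.toLinearMap.compDer d.mapCoeffs

@[simp]
theorem coeff_polynomial (P : A[X]) (n : ℕ) : (d.polynomial P).coeff n = d (P.coeff n) := rfl

@[simp]
theorem polynomial_C (a : A) : d.polynomial (C a) = C (d a) := by
  ext n
  rw [coeff_polynomial, coeff_C, coeff_C]
  split_ifs <;> simp

theorem iterate_polynomial_C (a : A) (n : ℕ) : d.polynomial^[n] (C a) = C (d^[n] a) := by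
  induction n with
  | zero => rfl
  | succ n ih => rw [Function.iterate_succ_apply', ih, polynomial_C, Function.iterate_succ_apply']

theorem derivative_polynomial (P : A[X]) :
    derivative (d.polynomial P) = d.polynomial (derivative P) := by
  ext n
  rw [coeff_derivative, coeff_polynomial, coeff_polynomial, coeff_derivative, leibniz]
  have : d ((n : A) + 1) = 0 := by simp
  simp [this, mul_comm]

theorem eval_one_polynomial (P : A[X]) : (d.polynomial P).eval 1 = d (P.eval 1) := by
  have h : (d.polynomial P).natDegree ≤ P.natDegree := by
    refine natDegree_le_iff_coeff_eq_zero.2 fun n hn ↦ ?_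
    rw [coeff_polynomial, coeff_eq_zero_of_natDegree_lt hn, map_zero]
  rw [eval_eq_sum_range' (Nat.lt_succ_of_le h), eval_eq_sum_range, map_sum]
  simp

/-- The polynomial in `X` obtained by applying `(d + X g)ⁿ` to `1`; it interpolates between
`dⁿ 1` and `(d + g)ⁿ 1`. -/
noncomputable def twistPolynomial (g : A) (n : ℕ) : A[X] :=
  (d.polynomial.twist (C g * X) ^ n) 1

theorem twistPolynomial_succ (g : A) (n : ℕ) :
    d.twistPolynomial g (n + 1) =
      d.polynomial (d.twistPolynomial g n) + C g * X * d.twistPolynomial g n := by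
  rw [twistPolynomial, pow_succ', Module.End.mul_apply, twist_apply, ← twistPolynomial]

theorem eval_one_twistPolynomial (g : A) (n : ℕ) :
    (d.twistPolynomial g n).eval 1 = (d.twist g ^ n) 1 := by
  induction n with
  | zero => simp [twistPolynomial]
  | succ n ih =>
    rw [twistPolynomial_succ, pow_succ', Module.End.mul_apply, twist_apply, ← ih, eval_add,
      eval_one_polynomial]
    simp

theorem coeff_twistPolynomial_of_lt (g : A) {n j : ℕ} (h : n < j) :
    (d.twistPolynomial g n).coeff j = 0 := by
  induction n generalizing j with
  | zero => simp [twistPolynomial, coeff_one, h.ne']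
  | succ n ih =>
    obtain ⟨j, rfl⟩ := Nat.exists_eq_succ_of_ne_zero (Nat.ne_zero_of_lt h)
    rw [twistPolynomial_succ, coeff_add, coeff_polynomial, mul_assoc, coeff_C_mul,
      coeff_X_mul, ih (by omega), ih (by omega)]
    simp

theorem coeff_twistPolynomial_self (g : A) (n : ℕ) :
    (d.twistPolynomial g n).coeff n = g ^ n := by
  induction n with
  | zero => simp [twistPolynomial]
  | succ n ih =>
    rw [twistPolynomial_succ, coeff_add, coeff_polynomial, mul_assoc, coeff_C_mul,
      coeff_X_mul, ih, coeff_twistPolynomial_of_lt d g (Nat.lt_succ_self n), map_zero, zero_add,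
      pow_succ']

theorem coeff_zero_twistPolynomial (g : A) {n : ℕ} (hn : n ≠ 0) :
    (d.twistPolynomial g n).coeff 0 = 0 := by
  induction n with
  | zero => exact absurd rfl hn
  | succ n ih =>
    rw [twistPolynomial_succ, coeff_add, coeff_polynomial, mul_assoc, coeff_C_mul,
      coeff_X_mul_zero, mul_zero, add_zero]
    rcases eq_or_ne n 0 with rfl | h
    · simp [twistPolynomial]
    · rw [ih h, map_zero]

theorem derivative_add_C_mul_twist_pow (f : A) (n : ℕ) (P : A[X]) :
    derivative ((d.polynomial.twist (C (d f) * X) ^ n) P) +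
        C f * (d.polynomial.twist (C (d f) * X) ^ n) P =
      (d.polynomial.twist (C (d f) * X) ^ n) (derivative P + C f * P) := by
  induction n generalizing P with
  | zero => simp
  | succ n ih =>
    rw [pow_succ, Module.End.mul_apply, Module.End.mul_apply, ih]
    congr 1
    simp only [twist_apply, map_add, derivative_mul, derivative_C, derivative_X,
      derivative_polynomial, leibniz, polynomial_C, smul_eq_mul]
    ring

end CommRing

section Field

variable [Field k] [Algebra k A] (d : Derivation k A A) (p : ℕ) [Fact p.Prime] [CharP k p]

theorem twist_pow_char_mul [Nontrivial A] (h : A) {u : A} (hu : d^[p] u = 0) (v : A) :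
    (d.twist h ^ p) (u * v) = u * (d.twist h ^ p) v := by
  have : CharP (Module.End k (Module.End k A)) p := charP_of_injective_algebraMap' k p
  have key := ad_twist_pow_mulLeft d h u p
  have hsub := sub_pow_char_of_commute (R := Module.End k (Module.End k A)) p
    (LinearMap.commute_mulLeft_right (d.twist h) (d.twist h))
  rw [hsub, LinearMap.pow_mulLeft,
    LinearMap.pow_mulRight, hu] at key
  simpa [sub_eq_zero] using LinearMap.congr_fun key v

/-- The `p`-curvature of `d + d f` is `(d f) ^ p`, for a derivation `d` with `d ^ p = 0`. -/
theorem twist_pow_char [Nontrivial A] (hd : ∀ u, d^[p] u = 0) (f : A) :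
    d.twist (d f) ^ p = LinearMap.mulLeft k (d f ^ p) := by
  have hp : p ≠ 0 := (Fact.out : p.Prime).ne_zero
  set W := d.twistPolynomial (d f) p with hW
  have hder : derivative W = 0 := by
    have h := derivative_add_C_mul_twist_pow d f p 1
    have h' := twist_pow_char_mul d.polynomial p (C (d f) * X) (u := C f)
      (by rw [iterate_polynomial_C, hd, C_0]) 1
    rw [derivative_one, zero_add, h', ← twistPolynomial, ← hW] at h
    linear_combination h
  have hcoeff : W = C (d f ^ p) * X ^ p := by
    ext j
    rw [coeff_C_mul, coeff_X_pow]
    rcases lt_trichotomy j p with h | rfl | h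
    · rw [if_neg h.ne, mul_zero]
      rcases eq_or_ne j 0 with rfl | hj
      · exact coeff_zero_twistPolynomial d _ hp
      · obtain ⟨i, rfl⟩ := Nat.exists_eq_succ_of_ne_zero hj
        have hc : W.coeff (i + 1) * ((i : A) + 1) = 0 := by
          rw [← coeff_derivative, hder, coeff_zero]
        have hk : ((i + 1 : ℕ) : k) ≠ 0 := fun h0 ↦
          Nat.not_dvd_of_pos_of_lt i.succ_pos h ((CharP.cast_eq_zero_iff k p _).1 h0)
        have hs : ((i + 1 : ℕ) : k) • W.coeff (i + 1) = 0 := by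
          rw [Nat.cast_smul_eq_nsmul, nsmul_eq_mul, mul_comm]
          exact_mod_cast hc
        exact (smul_eq_zero_iff_right hk).1 hs
    · rw [if_pos rfl, mul_one]
      exact coeff_twistPolynomial_self d _ _
    · rw [if_neg h.ne', mul_zero]
      exact coeff_twistPolynomial_of_lt d _ h
  ext u
  have h := twist_pow_char_mul d p (d f) (hd u) 1
  rw [mul_one, ← eval_one_twistPolynomial, ← hW, hcoeff] at h
  simpa [mul_comm] using h

end Field

end Derivation

namespace LinearMap

variable {R M : Type*} [Ring R] [AddCommGroup M] [Module R M]

theorem length_quotient_range_mul (a b : Module.End R M) (hb : Function.Injective b) :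
    Module.length R (M ⧸ range (b * a)) =
      Module.length R (M ⧸ range a) + Module.length R (M ⧸ range b) := by
  have hab : range (b * a) ≤ range b := range_comp_le_range a b
  have hle : range a ≤ (range (b * a)).comap b := by
    rintro _ ⟨u, rfl⟩
    exact ⟨u, rfl⟩
  refine Module.length_eq_add_of_exact ((range a).mapQ _ b hle) (Submodule.factor hab)
    ?_ (Submodule.factor_surjective hab) ?_
  · rw [← ker_eq_bot, Submodule.ker_mapQ, ← le_bot_iff, Submodule.map_le_iff_le_comap,
      Submodule.comap_bot, Submodule.ker_mkQ]
    rintro u ⟨v, hv⟩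
    exact ⟨v, hb hv⟩
  · intro x
    obtain ⟨x, rfl⟩ := Submodule.mkQ_surjective _ x
    rw [Submodule.mkQ_apply, Submodule.factor, Submodule.mapQ_apply, LinearMap.id_apply,
      Submodule.Quotient.mk_eq_zero]
    constructor
    · rintro ⟨v, rfl⟩
      exact ⟨Submodule.Quotient.mk v, rfl⟩
    · rintro ⟨v, hv⟩
      obtain ⟨v, rfl⟩ := Submodule.mkQ_surjective _ v
      rw [Submodule.mkQ_apply, Submodule.mapQ_apply, Submodule.Quotient.eq] at hv
      have hx := sub_mem (LinearMap.mem_range_self b v) (hab hv)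
      rwa [sub_sub_cancel] at hx

theorem length_quotient_range_pow (a : Module.End R M) (ha : Function.Injective a) (n : ℕ) :
    Module.length R (M ⧸ range (a ^ n)) = n * Module.length R (M ⧸ range a) := by
  induction n with
  | zero =>
    have : Subsingleton (M ⧸ range (a ^ 0)) := by
      rw [Submodule.Quotient.subsingleton_iff, range_eq_top]
      exact Function.surjective_id
    simp [Module.length_eq_zero]
  | succ n ih => rw [pow_succ', length_quotient_range_mul _ _ ha, ih]; push_cast; ring

end LinearMap

namespace PowerSeries

theorem iterate_derivative_char {R : Type*} [CommRing R] (p : ℕ) [Fact p.Prime] [CharP R p]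
    (u : R⟦X⟧) : (derivative R)^[p] u = 0 := by
  ext n
  have h : (((n + 1).ascFactorial p : ℕ) : R) = 0 := (CharP.cast_eq_zero_iff R p _).2 <|
    (Nat.dvd_factorial (Fact.out : p.Prime).pos le_rfl).trans (Nat.factorial_dvd_ascFactorial _ _)
  have h' := coeff_iterate_derivative u p n
  rw [h', map_zero]
  rw [h, zero_mul]

variable {k : Type*} [Field k]

theorem range_mulLeft_eq_ker_coeff {h : k⟦X⟧} {m : ℕ} (hm : h.order = m) :
    LinearMap.range (LinearMap.mulLeft k h) =
      LinearMap.ker (LinearMap.pi fun i : Fin m ↦ (coeff (R := k) (i : ℕ))) := by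
  have hh : h ≠ 0 := by
    rintro rfl
    simp at hm
  have hX : h = X ^ m * divXPowOrder h := by
    conv_lhs => rw [← X_pow_order_mul_divXPowOrder (f := h), hm, ENat.toNat_natCast]
  have hassoc : Associated (X ^ m) h :=
    ⟨(isUnit_divided_by_X_pow_order hh).unit, hX.symm⟩
  ext u
  have : u ∈ LinearMap.range (LinearMap.mulLeft k h) ↔ X ^ m ∣ u := by
    rw [hassoc.dvd_iff_dvd_left]
    exact ⟨fun ⟨v, hv⟩ ↦ ⟨v, hv.symm⟩, fun ⟨v, hv⟩ ↦ ⟨v, hv.symm⟩⟩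
  rw [this, X_pow_dvd_iff, LinearMap.mem_ker, funext_iff, Fin.forall_iff]
  rfl

theorem length_quotient_range_mulLeft {h : k⟦X⟧} {m : ℕ} (hm : h.order = m) :
    Module.length k (k⟦X⟧ ⧸ LinearMap.range (LinearMap.mulLeft k h)) = m := by
  have hs : Function.Surjective (LinearMap.pi fun i : Fin m ↦ (coeff (R := k) (i : ℕ))) :=
    fun c ↦ ⟨mk fun n ↦ if hn : n < m then c ⟨n, hn⟩ else 0, by ext i; simp⟩
  rw [range_mulLeft_eq_ker_coeff hm, (LinearMap.quotKerEquivOfSurjective _ hs).length_eq,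
    Module.length_eq_finrank, Module.finrank_fin_fun]

end PowerSeries


open PowerSeries

/-- Let `k` be a perfect field of characteristic `p > 0` and `f ∈ k⟦t⟧` a formal power
series with nonzero formal derivative.  Then the `k`-linear map `u ↦ u′ + f′·u` on `k⟦t⟧`
is injective, and its cokernel is a finite-dimensional `k`-vector space of dimension
`ord(f′)`. -/
theorem statement7 {p : ℕ} (hp : p.Prime) {k : Type*} [Field k] [PerfectField k] [CharP k p]
    (f : PowerSeries k) (hf : PowerSeries.derivative k f ≠ 0)
    (D : PowerSeries k →ₗ[k] PowerSeries k)
    (hD : ∀ u, D u = PowerSeries.derivative k u + PowerSeries.derivative k f * u) :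
    Function.Injective D ∧
      FiniteDimensional k (PowerSeries k ⧸ LinearMap.range D) ∧
      ∀ n : ℕ, PowerSeries.order (PowerSeries.derivative k f) = n →
        Module.finrank k (PowerSeries k ⧸ LinearMap.range D) = n := by
  have : Fact p.Prime := ⟨hp⟩
  have hDt : D = (derivative k).twist (derivative k f) := LinearMap.ext hD
  have hpow : D ^ p = LinearMap.mulLeft k (derivative k f ^ p) :=
    hDt ▸ Derivation.twist_pow_char _ p (iterate_derivative_char p) f
  have hinj : Function.Injective D := by
    have h : Function.Injective (D ^ p) := by
      rw [hpow]
      exact mul_right_injective₀ (pow_ne_zero p hf)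
    rw [← Nat.sub_one_add_one hp.ne_zero, Module.End.coe_pow, Function.iterate_succ] at h
    exact h.of_comp
  have hlen {n : ℕ} (hn : order (derivative k f) = n) :
      Module.length k (k⟦X⟧ ⧸ LinearMap.range D) = n := by
    have h := LinearMap.length_quotient_range_pow D hinj p
    rw [hpow, length_quotient_range_mulLeft (m := p * n) (by simp [order_pow, hn])] at h
    refine (ENat.mul_right_strictMono (a := p) (mod_cast hp.ne_zero)
      (ENat.natCast_ne_top p)).injective ?_
    exact_mod_cast h.symm
  have hfin : FiniteDimensional k (k⟦X⟧ ⧸ LinearMap.range D) := by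
    obtain ⟨n, hn⟩ := ENat.ne_top_iff_exists.1 (order_eq_top.not.2 hf)
    rw [FiniteDimensional, ← Module.rank_lt_aleph0_iff, ← Cardinal.toENat_ne_top,
      ← Module.length_eq_rank, hlen hn.symm]
    exact ENat.natCast_ne_top n
  refine ⟨hinj, hfin, fun n hn ↦ ?_⟩
  have h := hlen hn
  rw [Module.length_eq_finrank] at h
  exact_mod_cast h
end

section
/- Let p be a prime, let A be a commutative ring in which the images of 1, 2, …, p−1 are invertible, let M be an A-module, and let θ, τ be commuting A-linear endomorphisms of M such that τ∘θ is nilpotent. Define the A-linear map ∇: M^{⊕p} → M^{⊕p} by ∇(m₀, m₁, …, m_{p−1}) := (1·m₁ + τθ(m₁), 2·m₂ + τθ(m₂), …, (p−1)·m_{p−1} + τθ(m_{p−1}), θ(m₀)), i.e. the component of ∇(m) in position w is (w+1)·m_{w+1} + τθ(m_{w+1}) for 0 ≤ w ≤ p−2 and θ(m₀) for w = p−1. Then there are isomorphisms of A-modules ker ∇ ≅ ker θ and coker ∇ ≅ coker θ. -/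
/-- The sum of a unit scalar and a nilpotent endomorphism is bijective. -/
lemma bijective_smul_add_of_isNilpotent {A M : Type*} [CommRing A] [AddCommGroup M] [Module A M]
    {c : A} (hc : IsUnit c) {N : Module.End A M} (hN : IsNilpotent N) :
    Function.Bijective fun x => c • x + N x := by
  have h : IsUnit (algebraMap A (Module.End A M) c + N) :=
    hN.isUnit_add_left_of_commute (hc.map _) (Algebra.commutes c N).symm
  exact (Module.End.isUnit_iff _).mp h


/-- Let `p` be prime, `A` a commutative ring in which the images of `1,…,p−1` are
invertible, `M` an `A`-module, and `θ, τ` commuting `A`-linear endomorphisms of `M` with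
`τ ∘ θ` nilpotent.  Define `∇ : M^{⊕p} → M^{⊕p}` by `(∇ m) w = (w+1)·m_{w+1} + τ(θ(m_{w+1}))`
for `0 ≤ w ≤ p−2` and `(∇ m) (p−1) = θ(m₀)`.  Then there are `A`-module isomorphisms
`ker ∇ ≅ ker θ` and `coker ∇ ≅ coker θ`. -/
theorem statement13 {p : ℕ} (hp : p.Prime) {A : Type*} [CommRing A]
    (hinv : ∀ i : ℕ, 1 ≤ i → i ≤ p - 1 → IsUnit (i : A))
    {M : Type*} [AddCommGroup M] [Module A M]
    (θ τ : M →ₗ[A] M) (hcomm : ∀ x, θ (τ x) = τ (θ x))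
    (hnil : IsNilpotent (τ ∘ₗ θ : Module.End A M))
    (nab : (Fin p → M) →ₗ[A] (Fin p → M))
    (hnab₁ : ∀ (mv : Fin p → M) (w : Fin p) (hw : (w : ℕ) + 1 < p),
      nab mv w = (((w : ℕ) + 1 : ℕ) : A) • mv ⟨(w : ℕ) + 1, hw⟩ +
        τ (θ (mv ⟨(w : ℕ) + 1, hw⟩)))
    (hnab₂ : ∀ (mv : Fin p → M) (w : Fin p), (w : ℕ) + 1 = p →
      nab mv w = θ (mv ⟨0, hp.pos⟩)) :
    Nonempty (↥(LinearMap.ker nab) ≃ₗ[A] ↥(LinearMap.ker θ)) ∧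
      Nonempty (((Fin p → M) ⧸ LinearMap.range nab) ≃ₗ[A] (M ⧸ LinearMap.range θ)) := by
  have hp0 := hp.pos
  have hbij (w : ℕ) (hw : w + 1 < p) :
      Function.Bijective fun x : M => ((w + 1 : ℕ) : A) • x + τ (θ x) :=
    bijective_smul_add_of_isNilpotent (hinv (w + 1) (by omega) (by omega)) hnil
  constructor
  · have hker (m : LinearMap.ker nab) : m.1 ⟨0, hp0⟩ ∈ LinearMap.ker θ := by
      rw [LinearMap.mem_ker, ← hnab₂ m.1 ⟨p - 1, by omega⟩ (Nat.sub_add_cancel hp0),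
        LinearMap.mem_ker.mp m.2, Pi.zero_apply]
    let e : LinearMap.ker nab →ₗ[A] LinearMap.ker θ :=
      (LinearMap.proj (⟨0, hp0⟩ : Fin p) ∘ₗ (LinearMap.ker nab).subtype).codRestrict _ hker
    refine ⟨LinearEquiv.ofBijective e ⟨?_, ?_⟩⟩
    · rw [injective_iff_map_eq_zero]
      intro m hm
      ext ⟨i, hi⟩
      rcases i with _ | w
      · exact congrArg Subtype.val hm
      · apply (hbij w hi).1
        have h := hnab₁ m.1 ⟨w, by omega⟩ hi
        rw [LinearMap.mem_ker.mp m.2, Pi.zero_apply] at h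
        simpa using h.symm
    · intro x
      refine ⟨⟨Pi.single ⟨0, hp0⟩ x.1, ?_⟩, Subtype.ext ?_⟩
      swap
      · exact Pi.single_eq_same (M := fun _ => M) (⟨0, hp0⟩ : Fin p) x.1
      rw [LinearMap.mem_ker]
      ext w
      by_cases hw : (w : ℕ) + 1 < p
      · simp [hnab₁ _ w hw]
      · simp [hnab₂ _ w (by omega)]
  · let φ : (Fin p → M) →ₗ[A] M ⧸ LinearMap.range θ :=
      (LinearMap.range θ).mkQ ∘ₗ LinearMap.proj ⟨p - 1, by omega⟩
    have hφ : Function.Surjective φ :=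
      (Submodule.mkQ_surjective _).comp (Function.surjective_eval _)
    have hker : LinearMap.range nab = LinearMap.ker φ := by
      ext v
      have hmem : v ∈ LinearMap.ker φ ↔ v ⟨p - 1, by omega⟩ ∈ LinearMap.range θ :=
        Submodule.Quotient.mk_eq_zero _
      rw [hmem]
      constructor
      · rintro ⟨m, rfl⟩
        exact ⟨_, (hnab₂ m _ (Nat.sub_add_cancel hp0)).symm⟩
      · rintro ⟨y, hy⟩
        choose g hg using fun (w : ℕ) (hw : w + 1 < p) => (hbij w hw).2 (v ⟨w, by omega⟩)
        refine ⟨fun i => match i with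
          | ⟨0, _⟩ => y
          | ⟨w + 1, hw⟩ => g w hw, ?_⟩
        ext w
        by_cases hw : (w : ℕ) + 1 < p
        · rw [hnab₁ _ w hw]
          exact hg w hw
        · rw [hnab₂ _ w (by omega)]
          have hlast : w = ⟨p - 1, by omega⟩ := Fin.ext (by dsimp only; omega)
          rw [hlast]
          exact hy
    exact ⟨(Submodule.quotEquivOfEq _ _ hker).trans (φ.quotKerEquivOfSurjective hφ)⟩
end
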